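/- Let Λ be an Eulerian lattice of rank n and ν∈Λ with ν > 0̂. Then the ab-index of the poset Λ_ν (with rank function inherited from Λ) is given by Ψ_{Λ_ν} = Σ_{ν ≤ π < 1̂} Ψ_{[0̂,π)} · a · (b−a)^{ρ(π,1̂)−1}, the sum taken over all π∈Λ with π ≥ ν. -/

import Mathlib

open scoped Classical

noncomputable section

/-- The ring of polynomials in two non-commuting variables `a`, `b` (with rational
coefficients), in which `ab`-indices and `cd`-indices live. -/
abbrev NC := FreeAlgebra ℚ (Fin 2)

/-- The variable `a`. -/
def va : NC := FreeAlgebra.ι ℚ 0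
/-- The variable `b`. -/
def vb : NC := FreeAlgebra.ι ℚ 1
/-- `c = a + b`. -/
def vc : NC := va + vb
/-- `d = ab + ba`. -/
def vd : NC := va * vb + vb * va

/-- A `cd`-monomial, encoded as a list of booleans (`false` = `c`, `true` = `d`),
viewed inside `NC` via `c = a+b`, `d = ab+ba`. -/
def cdMonomial : List Bool → NC
  | [] => 1
  | s :: w => (if s then vd else vc) * cdMonomial w

/-- Degree of a `cd`-monomial (`c` has degree 1, `d` has degree 2). -/
def cdDeg (w : List Bool) : ℕ := (w.map fun s => if s then 2 else 1).sum

/-- Evaluation of an integer combination of `cd`-monomials in `NC`. -/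
def cdEval (f : List Bool →₀ ℤ) : NC := f.sum fun w z => (z : ℚ) • cdMonomial w

/-- The weight of a chain, computed from the (strictly increasing) list of absolute ranks
of its elements; `N` is the absolute rank of the (possibly formal) maximal element `1̂`.
For a list `[r₀, r₁, …, r_k]` this is
`(a-b)^(r₁-r₀-1) · b · (a-b)^(r₂-r₁-1) · b ⋯ b · (a-b)^(N-1-r_k)`. -/
def wtRanks (N : ℕ) : List ℕ → NC
  | [] => 1
  | [r] => (va - vb) ^ (N - 1 - r)
  | r :: s :: l => (va - vb) ^ (s - r - 1) * vb * wtRanks N (s :: l)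


/-- A finite type has a finite `WithTop`. -/
instance {α : Type*} [Fintype α] : Fintype (WithTop α) := inferInstanceAs (Fintype (Option α))

/-- A lexicographic sum of finite types is finite. -/
instance {α β : Type*} [Fintype α] [Fintype β] : Fintype (α ⊕ₗ β) :=
  inferInstanceAs (Fintype (α ⊕ β))

section Posets

variable {P : Type*} [Fintype P] [PartialOrder P]

/-- `y` is a chain of the subposet `S ⊆ P` whose minimal element is `m`, containing `m`
(chains of a poset always contain the minimal element `0̂ = m`). -/
def chainIn (S : Set P) (m : P) (y : Finset P) : Prop :=
  m ∈ y ∧ ↑y ⊆ S ∧ IsChain (· < ·) (↑y : Set P)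

/-- The `ab`-index `Ψ` of the subposet `S ⊆ P` with minimal element `m`, of rank `n`
(so the adjoined maximal element `1̂` has absolute rank `rk m + n + 1`); ranks of
elements are computed by the ambient rank function `rk`. -/
def absIndexOn (S : Set P) (m : P) (rk : P → ℕ) (n : ℕ) : NC :=
  ∑ y : Finset P,
    if chainIn S m y then wtRanks (rk m + n + 1) ((y.image rk).sort (· ≤ ·)) else 0

/-- The simplicial boundary operator relative to a chain `x`: a chain `y ⊇ x` is sent to
the signed sum of the chains `y ∖ {σ}` for `σ ∈ y ∖ x`, the sign of `σ` being determined
by its position in `y`.  Together with the grading by cardinality, this is the cellular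
(chain) complex of the order complex computing (relative) simplicial homology. -/
def bnd (x : Finset P) : (Finset P →₀ ℝ) →ₗ[ℝ] (Finset P →₀ ℝ) :=
  Finsupp.lsum ℝ fun y => LinearMap.id.smulRight
    (∑ σ ∈ y \ x, ((-1 : ℝ) ^ (y.filter fun τ => τ < σ).card) • Finsupp.single (y.erase σ) (1 : ℝ))

/-- The degree-`k` term of the cellular complex of (the order complex of) the subposet
`S` with minimal element `m`, relative to the chain `x`: the span of all chains `y ⊇ x`
in `S` with `k` elements. -/
def cellSpace (S : Set P) (m : P) (x : Finset P) (k : ℕ) : Submodule ℝ (Finset P →₀ ℝ) :=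
  Submodule.span ℝ
    {f | ∃ y : Finset P, chainIn S m y ∧ x ⊆ y ∧ y.card = k ∧ f = Finsupp.single y 1}

/-- The homological Gorenstein condition for the subposet `S ⊆ P` with minimal element
`m`, of rank `n`: the order complex is a real homology sphere, i.e. for every chain `x`
the cellular complex of the interval `[x, 1̂)` of the order complex is exact except at the
top (chains of `n+1` elements), where the homology is 1-dimensional. -/
def GorensteinOn (S : Set P) (m : P) (n : ℕ) : Prop :=
  ∀ x : Finset P, chainIn S m x → ∀ k : ℕ,
    Module.finrank ℝ ↥(LinearMap.ker (bnd x) ⊓ cellSpace S m x k) =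
      Module.finrank ℝ ↥(Submodule.map (bnd x) (cellSpace S m x (k + 1))) +
        (if k = n + 1 then 1 else 0)

/-- `S ⊆ P` is a graded (sub)poset of rank `n` with minimal element `m`: covers in `S`
increase the ambient rank `rk` by one, and all maximal elements of `S` have rank
`rk m + n`. -/
def IsGradedOn (S : Set P) (m : P) (rk : P → ℕ) (n : ℕ) : Prop :=
  m ∈ S ∧ (∀ x ∈ S, m ≤ x) ∧
    (∀ a ∈ S, ∀ b ∈ S, a < b → (¬ ∃ c ∈ S, a < c ∧ c < b) → rk b = rk a + 1) ∧
    (∀ a ∈ S, (∀ b ∈ S, ¬ a < b) → rk a = rk m + n)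

/-- `S ⊆ P` (with minimal element `m` and ambient rank function `rk`) is a Gorenstein*
poset of rank `n`. -/
def IsGorensteinStarOn (S : Set P) (m : P) (rk : P → ℕ) (n : ℕ) : Prop :=
  IsGradedOn S m rk n ∧ GorensteinOn S m n

/-- The pair `(S, B)` (with minimal element `m` and ambient rank function `rk`) is a
near-Gorenstein* poset of rank `n` with boundary `B`: `B` is an order ideal of `S` of
rank `n-1` which is Gorenstein* of rank `n-1`, and the order complex of `S` is a real
homology ball with boundary the order complex of `B`: for every chain `x` of `S`, the
cellular complex of `[x, 1̂)` is exact, except that when `x` is not a chain of `B` the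
homology at the top is 1-dimensional. -/
def IsNearGorensteinStarOn (S B : Set P) (m : P) (rk : P → ℕ) (n : ℕ) : Prop :=
  IsGradedOn S m rk n ∧ B ⊆ S ∧ (∀ σ ∈ B, ∀ τ ∈ S, τ ≤ σ → τ ∈ B) ∧
    IsGradedOn B m rk (n - 1) ∧ GorensteinOn B m (n - 1) ∧
    ∀ x : Finset P, chainIn S m x → ∀ k : ℕ,
      Module.finrank ℝ ↥(LinearMap.ker (bnd x) ⊓ cellSpace S m x k) =
        Module.finrank ℝ ↥(Submodule.map (bnd x) (cellSpace S m x (k + 1))) +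
          (if k = n + 1 ∧ ¬(↑x ⊆ B) then 1 else 0)

end Posets

end

section AbIndexLambdaNu

lemma wtRanks_mul_va (n p : ℕ) (hp : p ≤ n) (l : List ℕ) (hl : l ≠ []) (h : ∀ x ∈ l, x < p) :
    wtRanks p l * va * (vb - va) ^ (n - p) =
      ((-1 : ℤ) ^ (n - p)) • (wtRanks (n + 1) l + wtRanks (n + 1) (l ++ [p])) := by
  have hba : vb - va = (-1 : ℤ) • (va - vb) := by simp
  rw [hba, smul_pow, mul_smul_comm]
  congr 1
  induction l with
  | nil => exact absurd rfl hl
  | cons r l ih =>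
    cases l with
    | nil =>
      have hr : r < p := h r (by simp)
      have e1 : n + 1 - 1 - r = (p - 1 - r) + 1 + (n - p) := by omega
      have e2 : n + 1 - 1 - p = n - p := by omega
      have e3 : p - r - 1 = p - 1 - r := by omega
      simp only [wtRanks, List.cons_append, List.nil_append, e1, e2, e3, pow_add, pow_one]
      noncomm_ring
    | cons s l =>
      have := ih (by simp) fun x hx => h x (List.mem_cons_of_mem _ hx)
      simp only [wtRanks, List.cons_append] at this ⊢
      rw [← mul_add, ← this]
      simp only [mul_assoc]

lemma Finset.sort_insert_of_forall_lt (s : Finset ℕ) (p : ℕ) (h : ∀ x ∈ s, x < p) :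
    (insert p s).sort (· ≤ ·) = s.sort (· ≤ ·) ++ [p] := by
  refine List.Perm.eq_of_pairwise' (r := (· ≤ ·)) (Finset.pairwise_sort _ _) ?_ ?_
  · rw [List.pairwise_append]
    refine ⟨Finset.pairwise_sort _ _, by simp, fun a ha b hb => ?_⟩
    rw [List.mem_singleton.1 hb]
    exact (h a ((Finset.mem_sort _).1 ha)).le
  · refine (List.perm_ext_iff_of_nodup (Finset.sort_nodup _ _) ?_).2 fun a => ?_
    · rw [List.nodup_append]
      refine ⟨Finset.sort_nodup _ _, by simp, fun a ha b hb => ?_⟩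
      rw [List.mem_singleton.1 hb]
      exact (h a ((Finset.mem_sort _).1 ha)).ne
    · simp [or_comm]

variable {P : Type*} [PartialOrder P]

lemma chainIn.exists_isGreatest {S : Set P} {m : P} {y : Finset P} (h : chainIn S m y) :
    ∃ σ ∈ y, ∀ x ∈ y, x ≤ σ := by
  obtain ⟨σ, hσ, hmax⟩ := y.exists_maximal ⟨m, h.1⟩
  refine ⟨σ, hσ, fun x hx => ?_⟩
  by_contra hne
  rcases h.2.2 hx hσ (fun e => hne e.le) with hlt | hlt
  · exact hne hlt.le
  · exact hne (hmax hx hlt.le)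

lemma chainIn_Iio_iff {m π : P} {y : Finset P} :
    chainIn (Set.Iio π) m y ↔ chainIn (Set.Iic π) m y ∧ π ∉ y := by
  constructor
  · rintro ⟨h1, h2, h3⟩
    exact ⟨⟨h1, fun x hx => (h2 hx).le, h3⟩, fun hπ => lt_irrefl _ (h2 hπ)⟩
  · rintro ⟨⟨h1, h2, h3⟩, h4⟩
    exact ⟨h1, fun x hx => lt_of_le_of_ne (h2 hx) fun e => h4 (e ▸ hx), h3⟩

lemma chainIn.insert_Iic {m π : P} {y : Finset P} (h : chainIn (Set.Iio π) m y) :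
    chainIn (Set.Iic π) m (insert π y) := by
  obtain ⟨h1, h2, h3⟩ := h
  refine ⟨Finset.mem_insert_of_mem h1, fun x hx => ?_, ?_⟩
  · rcases Finset.mem_insert.1 hx with rfl | hx
    · exact le_rfl
    · exact (h2 hx).le
  · rw [Finset.coe_insert]
    exact h3.insert fun b hb _ => Or.inr (h2 hb)

lemma chainIn.erase_Iio {m π : P} (hm : m ≠ π) {y : Finset P} (h : chainIn (Set.Iic π) m y) :
    chainIn (Set.Iio π) m (y.erase π) := by
  obtain ⟨h1, h2, h3⟩ := h
  refine chainIn_Iio_iff.2 ⟨⟨Finset.mem_erase.2 ⟨hm, h1⟩, fun x hx => ?_, ?_⟩,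
    Finset.notMem_erase _ _⟩
  · exact h2 (Finset.mem_of_mem_erase hx)
  · exact h3.mono fun x hx => Finset.mem_of_mem_erase hx

variable [Fintype P]

lemma IsGradedOn.strictMono {m : P} {rk : P → ℕ} {n : ℕ}
    (h : IsGradedOn (Set.univ : Set P) m rk n) : StrictMono rk := by
  let := Fintype.toLocallyFiniteOrder (α := P)
  intro a b hab
  have key := transGen_covBy_of_lt hab
  clear hab
  have cov : ∀ x y : P, x ⋖ y → rk x < rk y := fun x y hxy => by
    rw [h.2.2.1 x trivial y trivial hxy.lt fun ⟨c, _, h1, h2⟩ => hxy.2 h1 h2]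
    exact Nat.lt_succ_self _
  induction key with
  | single hx => exact cov _ _ hx
  | tail _ hx ih => exact ih.trans (cov _ _ hx)

lemma IsGradedOn.rk_le {m : P} {rk : P → ℕ} {n : ℕ}
    (h : IsGradedOn (Set.univ : Set P) m rk n) (x : P) : rk x ≤ rk m + n := by
  obtain ⟨y, hxy, hy⟩ := Finite.exists_le_maximal (p := fun _ : P => True) (a := x) trivial
  rw [← h.2.2.2 y trivial fun b _ hb => hy.not_prop_of_gt hb trivial]
  exact h.strictMono.monotone hxy

lemma sum_eulerian_top (rk : P → ℕ) (n : ℕ)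
    (heul : ∀ x y : WithTop P, x < y →
      (∑ z : WithTop P, if x ≤ z ∧ z ≤ y then
        ((-1 : ℤ) ^ (WithTop.recTopCoe (n + 1) rk z - WithTop.recTopCoe (n + 1) rk x))
        else 0) = 0) (τ : P) :
    (-1 : ℤ) ^ (n + 1 - rk τ) + ∑ z : P, (if τ ≤ z then (-1 : ℤ) ^ (rk z - rk τ) else 0) = 0 := by
  have h := heul τ ⊤ (WithTop.coe_lt_top τ)
  have hopt (f : WithTop P → ℤ) : ∑ z, f z = f ⊤ + ∑ z : P, f z := Fintype.sum_option f
  simpa only [hopt, le_top, and_true, if_true, WithTop.coe_le_coe, WithTop.recTopCoe_top,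
    WithTop.recTopCoe_coe] using h

lemma sum_chainIn_Iic {M : Type*} [AddCommMonoid M] (W : Finset P → M) {m π : P} (hm : m ≠ π) :
    (∑ y : Finset P, if chainIn (Set.Iic π) m y then W y else 0) =
      ∑ y : Finset P, if chainIn (Set.Iio π) m y then W y + W (insert π y) else 0 := by
  simp only [← Finset.sum_filter]
  rw [Finset.sum_add_distrib, ← Finset.sum_filter_add_sum_filter_not _ (fun y => π ∉ y)]
  congr 1
  · refine Finset.sum_congr ?_ fun _ _ => rfl
    ext y
    simp [chainIn_Iio_iff]
  · refine Finset.sum_bij' (fun y _ => y.erase π) (fun y _ => insert π y) ?_ ?_ ?_ ?_ ?_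
    · intro y hy
      simp only [Finset.mem_filter, Finset.mem_univ, true_and] at hy ⊢
      exact hy.1.erase_Iio hm
    · intro y hy
      simp only [Finset.mem_filter, Finset.mem_univ, true_and] at hy ⊢
      exact ⟨hy.insert_Iic, by simp⟩
    · intro y hy
      simp only [Finset.mem_filter, not_not] at hy
      exact Finset.insert_erase hy.2
    · intro y hy
      simp only [Finset.mem_filter, Finset.mem_univ, true_and] at hy
      exact Finset.erase_insert (chainIn_Iio_iff.1 hy).2
    · intro y hy
      simp only [Finset.mem_filter, not_not] at hy
      rw [Finset.insert_erase hy.2]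

lemma absIndexOn_Iio_mul {rk : P → ℕ} {n : ℕ} {m π : P} (hrk : StrictMono rk) (hm : rk m = 0)
    (hπ : m < π) (hn : rk π ≤ n) :
    absIndexOn {x : P | x < π} m rk (rk π - 1) * va * (vb - va) ^ (n - rk π) =
      ∑ y : Finset P, if chainIn (Set.Iic π) m y then
        ((-1 : ℤ) ^ (n - rk π)) • wtRanks (n + 1) ((y.image rk).sort (· ≤ ·)) else 0 := by
  have h0 : rk m + (rk π - 1) + 1 = rk π := by
    have := hrk hπ
    omega
  rw [sum_chainIn_Iic _ hπ.ne, absIndexOn, h0, Finset.sum_mul, Finset.sum_mul]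
  refine Finset.sum_congr rfl fun y _ => ?_
  rw [show {x : P | x < π} = Set.Iio π from rfl]
  split_ifs with hy
  · have hlt : ∀ x ∈ y.image rk, x < rk π := by
      intro x hx
      obtain ⟨z, hz, rfl⟩ := Finset.mem_image.1 hx
      exact hrk (hy.2.1 hz)
    rw [wtRanks_mul_va n (rk π) hn, Finset.image_insert,
      Finset.sort_insert_of_forall_lt _ _ hlt, smul_add]
    · intro he
      have : rk m ∈ (y.image rk).sort (· ≤ ·) :=
        (Finset.mem_sort _).2 (Finset.mem_image_of_mem _ hy.1)
      rw [he] at this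
      exact List.not_mem_nil this
    · exact fun x hx => hlt x ((Finset.mem_sort _).1 hx)
  · simp

end AbIndexLambdaNu

/-- **Proposition.** Let `Λ` be an Eulerian lattice of rank `n` (no maximal element;
`j` is the join operation of `Λ ∪ {1̂} = WithTop Λ`) and `ν > 0̂`.  Then the `ab`-index
of the poset `Λ_ν = {σ ∈ Λ | σ ∨ ν < 1̂}` (with rank function inherited from `Λ`) is
`Ψ_{Λ_ν} = Σ_{ν ≤ π < 1̂} Ψ_{[0̂,π)} · a · (b-a)^{ρ(π,1̂)-1}`. -/
theorem abIndex_lambda_nu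
    {Λ : Type*} [Fintype Λ] [PartialOrder Λ] [OrderBot Λ]
    (rk : Λ → ℕ) (n : ℕ)
    (j : Λ → Λ → WithTop Λ)
    (hj : ∀ x y : Λ, IsLUB {(↑x : WithTop Λ), ↑y} (j x y))
    (hgr : IsGradedOn (Set.univ : Set Λ) (⊥ : Λ) rk n)
    (heul : ∀ x y : WithTop Λ, x < y →
      (∑ z : WithTop Λ, if x ≤ z ∧ z ≤ y then
        ((-1 : ℤ) ^ (WithTop.recTopCoe (n + 1) rk z - WithTop.recTopCoe (n + 1) rk x))
        else 0) = 0)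
    (ν : Λ) (hν : ⊥ < ν) :
    absIndexOn {σ : Λ | j σ ν ≠ ⊤} (⊥ : Λ) rk n =
      ∑ π : Λ, if ν ≤ π then
        absIndexOn {x : Λ | x < π} (⊥ : Λ) rk (rk π - 1) * va * (vb - va) ^ (n - rk π)
      else 0 := by
  have hmono := hgr.strictMono
  have hsum := sum_eulerian_top rk n heul
  have hbot : rk ⊥ = 0 := by
    obtain ⟨τ, -, hτ⟩ := Finite.exists_le_maximal (p := fun _ : Λ => True) (a := ⊥) trivial
    have hrkτ := hgr.2.2.2 τ trivial fun b _ hb => hτ.not_prop_of_gt hb trivial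
    have h := hsum τ
    rw [Finset.sum_eq_single τ
      (fun b _ hb => if_neg fun hle => hb (le_antisymm (hτ.2 trivial hle) hle)) (by simp)] at h
    by_contra h0
    rw [show n + 1 - rk τ = 0 by omega] at h
    simp at h
  have hle : ∀ x, rk x ≤ n := fun x => by simpa [hbot] using hgr.rk_le x
  have htop : ∀ τ : Λ, ∑ π : Λ, (if τ ≤ π then (-1 : ℤ) ^ (n - rk π) else 0) = 1 := by
    intro τ
    have h := hsum τ
    rw [show n + 1 - rk τ = (n - rk τ) + 1 by have := hle τ; omega] at h
    have e : ∑ π : Λ, (if τ ≤ π then (-1 : ℤ) ^ (n - rk π) else 0) =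
        (-1 : ℤ) ^ (n - rk τ) * ∑ π : Λ, (if τ ≤ π then (-1 : ℤ) ^ (rk π - rk τ) else 0) := by
      rw [Finset.mul_sum]
      refine Finset.sum_congr rfl fun π _ => ?_
      split_ifs with hπ
      · have h1 := hle π
        have h2 := hmono.monotone hπ
        rw [show n - rk τ = (n - rk π) + (rk π - rk τ) by omega, pow_add, mul_assoc, ← mul_pow]
        simp
      · simp
    rw [e, eq_neg_of_add_eq_zero_right h, pow_succ, mul_neg, ← mul_assoc, ← mul_pow]
    simp
  have hjle : ∀ σ π : Λ, j σ ν ≤ (π : WithTop Λ) ↔ σ ≤ π ∧ ν ≤ π := by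
    intro σ π
    rw [isLUB_le_iff (hj σ ν)]
    simp [upperBounds]
  have hcoef : ∀ y : Finset Λ,
      (∑ π : Λ, if ν ≤ π ∧ chainIn (Set.Iic π) ⊥ y then (-1 : ℤ) ^ (n - rk π) else 0) =
        if chainIn {σ : Λ | j σ ν ≠ ⊤} ⊥ y then 1 else 0 := by
    intro y
    by_cases hy : chainIn (Set.univ : Set Λ) ⊥ y
    · obtain ⟨σ, hσ, hmax⟩ := hy.exists_isGreatest
      have hIic : ∀ π, (ν ≤ π ∧ chainIn (Set.Iic π) ⊥ y) ↔ j σ ν ≤ (π : WithTop Λ) := by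
        intro π
        rw [hjle, and_comm]
        exact and_congr_left' ⟨fun h => h.2.1 hσ,
          fun h => ⟨hy.1, fun x hx => (hmax x hx).trans h, hy.2.2⟩⟩
      have hS : chainIn {σ : Λ | j σ ν ≠ ⊤} ⊥ y ↔ j σ ν ≠ ⊤ := by
        refine ⟨fun h => h.2.1 hσ, fun h => ⟨hy.1, fun x hx => ?_, hy.2.2⟩⟩
        obtain ⟨τ, hτ⟩ := WithTop.ne_top_iff_exists.1 h
        have hτ' := (hjle σ τ).1 hτ.ge
        exact ne_top_of_le_ne_top WithTop.coe_ne_top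
          ((hjle x τ).2 ⟨(hmax x hx).trans hτ'.1, hτ'.2⟩)
      simp only [hIic, hS]
      by_cases h : j σ ν = ⊤
      · simp [h]
      · obtain ⟨τ, hτ⟩ := WithTop.ne_top_iff_exists.1 h
        rw [if_pos h, ← hτ]
        simpa only [WithTop.coe_le_coe] using htop τ
    · have hno : ∀ S : Set Λ, ¬ chainIn S ⊥ y := fun S h => hy ⟨h.1, Set.subset_univ _, h.2.2⟩
      simp [hno]
  have hR : ∀ π : Λ, (if ν ≤ π then
      absIndexOn {x : Λ | x < π} (⊥ : Λ) rk (rk π - 1) * va * (vb - va) ^ (n - rk π) else 0) =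
      ∑ y : Finset Λ, (if ν ≤ π ∧ chainIn (Set.Iic π) ⊥ y then (-1 : ℤ) ^ (n - rk π) else 0) •
        wtRanks (n + 1) ((y.image rk).sort (· ≤ ·)) := by
    intro π
    split_ifs with h
    · rw [absIndexOn_Iio_mul hmono hbot (hν.trans_le h) (hle π)]
      simp [h, ite_smul]
    · simp [h]
  rw [Finset.sum_congr rfl fun π _ => hR π, Finset.sum_comm, absIndexOn]
  refine Finset.sum_congr rfl fun y _ => ?_
  rw [← Finset.sum_smul, hcoef, hbot, zero_add, ite_smul, one_smul, zero_smul]
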